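/- arXiv:2211.07048 — 8 statements merged into one kernel-verified Lean document; each statement's English description precedes it below -/
import Mathlib

section
/- For every finite set A of integers and all nonzero integers β₁, β₂, β₃, β₄, the number of quadruples (a₁, a₂, a₃, a₄) ∈ A⁴ satisfying β₁a₁ + β₂a₂ + β₃a₃ + β₄a₄ = 0 is at most E(A). -/
/-- The additive energy of a finite set `A ⊆ ℤ`:
the number of quadruples `(a, b, c, d) ∈ A⁴` with `a + b = c + d`. -/
def additiveEnergy (A : Finset ℤ) : ℕ :=
  ((A ×ˢ A ×ˢ A ×ˢ A).filter fun t => t.1 + t.2.1 = t.2.2.1 + t.2.2.2).card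

open Finset in
theorem card_filter_eq_sum_card_fiber_mul {α β γ : Type*} [DecidableEq γ] (S : Finset α)
    (T : Finset β) (f : α → γ) (g : β → γ) (U : Finset γ) (hU : ∀ s ∈ S, f s ∈ U) :
    #{p ∈ S ×ˢ T | f p.1 = g p.2} = ∑ x ∈ U, #{s ∈ S | f s = x} * #{t ∈ T | g t = x} := by
  rw [card_eq_sum_card_fiberwise (f := fun p => f p.1) (t := U)]
  · refine sum_congr rfl fun x _ => ?_
    rw [← card_product]
    congr 1
    ext p
    simp only [mem_filter, mem_product]
    grind
  · intro p hp
    simp only [coe_filter, mem_product, Set.mem_ofPred_eq] at hp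
    exact hU _ hp.1.1

open Finset in
/-- The AM-GM form of the Cauchy-Schwarz inequality for the number of coincidences of two maps. -/
theorem two_mul_card_filter_eq_le {α β γ : Type*} [DecidableEq γ] (S : Finset α)
    (T : Finset β) (f : α → γ) (g : β → γ) :
    2 * #{p ∈ S ×ˢ T | f p.1 = g p.2} ≤
      #{p ∈ S ×ˢ S | f p.1 = f p.2} + #{p ∈ T ×ˢ T | g p.1 = g p.2} := by
  have hS : ∀ s ∈ S, f s ∈ S.image f ∪ T.image g := fun s hs =>
    mem_union_left _ (mem_image_of_mem f hs)
  have hT : ∀ t ∈ T, g t ∈ S.image f ∪ T.image g := fun t ht =>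
    mem_union_right _ (mem_image_of_mem g ht)
  rw [card_filter_eq_sum_card_fiber_mul S T f g _ hS, card_filter_eq_sum_card_fiber_mul S S f f _ hS,
    card_filter_eq_sum_card_fiber_mul T T g g _ hT, mul_sum, ← sum_add_distrib]
  refine sum_le_sum fun x _ => ?_
  have h := two_mul_le_add_sq #{s ∈ S | f s = x} #{t ∈ T | g t = x}
  rwa [sq, sq, mul_assoc] at h

open Finset in
theorem card_filter_mul_sub_eq (A : Finset ℤ) {b : ℤ} (hb : b ≠ 0) :
    #{p ∈ (A ×ˢ A) ×ˢ (A ×ˢ A) | b * (p.1.1 - p.1.2) = b * (p.2.1 - p.2.2)} =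
      additiveEnergy A := by
  refine card_nbij' (fun p => (p.1.1, p.2.2, p.2.1, p.1.2))
    (fun t => ((t.1, t.2.2.2), (t.2.2.1, t.2.1))) ?_ ?_ (fun _ _ => rfl) (fun _ _ => rfl)
  · intro p hp
    simp only [coe_filter, mem_product, Set.mem_ofPred_eq, mul_right_inj' hb] at hp ⊢
    exact ⟨by tauto, by linarith [hp.2]⟩
  · intro p hp
    simp only [coe_filter, mem_product, Set.mem_ofPred_eq, mul_right_inj' hb] at hp ⊢
    exact ⟨by tauto, by linarith [hp.2]⟩

open Finset in
theorem card_filter_linear_eq_le_additiveEnergy (A : Finset ℤ) {b c : ℤ} (hb : b ≠ 0)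
    (hc : c ≠ 0) :
    #{p ∈ (A ×ˢ A) ×ˢ (A ×ˢ A) | b * p.1.1 + c * p.1.2 = b * p.2.1 + c * p.2.2} ≤
      additiveEnergy A := by
  have h := two_mul_card_filter_eq_le (A ×ˢ A) (A ×ˢ A) (fun p => b * (p.1 - p.2))
    (fun p => c * (p.1 - p.2))
  rw [card_filter_mul_sub_eq A hb, card_filter_mul_sub_eq A hc] at h
  have h' : #{p ∈ (A ×ˢ A) ×ˢ (A ×ˢ A) | b * p.1.1 + c * p.1.2 = b * p.2.1 + c * p.2.2} =
      #{p ∈ (A ×ˢ A) ×ˢ (A ×ˢ A) | b * (p.1.1 - p.1.2) = c * (p.2.1 - p.2.2)} := by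
    refine card_nbij' (fun p => ((p.1.1, p.2.1), (p.2.2, p.1.2)))
      (fun p => ((p.1.1, p.2.2), (p.1.2, p.2.1))) ?_ ?_ (fun _ _ => rfl) (fun _ _ => rfl)
    · intro p hp
      simp only [coe_filter, mem_product, Set.mem_ofPred_eq] at hp ⊢
      exact ⟨by tauto, by linarith [hp.2]⟩
    · intro p hp
      simp only [coe_filter, mem_product, Set.mem_ofPred_eq] at hp ⊢
      exact ⟨by tauto, by linarith [hp.2]⟩
  omega

theorem count_four_term_solutions_le_energy (A : Finset ℤ) (β₁ β₂ β₃ β₄ : ℤ)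
    (h₁ : β₁ ≠ 0) (h₂ : β₂ ≠ 0) (h₃ : β₃ ≠ 0) (h₄ : β₄ ≠ 0) :
    ((A ×ˢ A ×ˢ A ×ˢ A).filter fun t =>
        β₁ * t.1 + β₂ * t.2.1 + β₃ * t.2.2.1 + β₄ * t.2.2.2 = 0).card
      ≤ additiveEnergy A := by
  have h := two_mul_card_filter_eq_le (A ×ˢ A) (A ×ˢ A) (fun p => β₁ * p.1 + β₂ * p.2)
    (fun p => -β₃ * p.1 + -β₄ * p.2)
  have hf := card_filter_linear_eq_le_additiveEnergy A h₁ h₂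
  have hg := card_filter_linear_eq_le_additiveEnergy A (neg_ne_zero.2 h₃) (neg_ne_zero.2 h₄)
  have h' : ((A ×ˢ A ×ˢ A ×ˢ A).filter fun t =>
        β₁ * t.1 + β₂ * t.2.1 + β₃ * t.2.2.1 + β₄ * t.2.2.2 = 0).card =
      (((A ×ˢ A) ×ˢ (A ×ˢ A)).filter fun p =>
        β₁ * p.1.1 + β₂ * p.1.2 = -β₃ * p.2.1 + -β₄ * p.2.2).card := by
    refine Finset.card_nbij' (fun t => ((t.1, t.2.1), t.2.2))
      (fun p => (p.1.1, p.1.2, p.2)) ?_ ?_ (fun _ _ => rfl) (fun _ _ => rfl)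
    · intro p hp
      simp only [Finset.coe_filter, Finset.mem_product, Set.mem_ofPred_eq] at hp ⊢
      exact ⟨by tauto, by linarith [hp.2]⟩
    · intro p hp
      simp only [Finset.coe_filter, Finset.mem_product, Set.mem_ofPred_eq] at hp ⊢
      exact ⟨by tauto, by linarith [hp.2]⟩
  omega
end

section
/- Let p and ℓ be positive integers and let r be an integer, and define h : ℤ → ℤ by h(t) = ⌊((r·t mod p) · ℓ) / p⌋, where a mod p denotes the representative of a in {0, 1, …, p−1}. Then for all integers x, y, z with x + y + z = 0, the sum h(x) + h(y) + h(z) lies in the set {0, ℓ−2, ℓ−1, ℓ, 2ℓ−2, 2ℓ−1, 2ℓ}. -/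
theorem exists_emod_add_emod_add_emod_eq_mul {p a b c : ℤ} (hp : 0 < p) (habc : a + b + c = 0) :
    ∃ k : ℤ, 0 ≤ k ∧ k < 3 ∧ a % p + b % p + c % p = k * p := by
  have ha := Int.emod_nonneg a hp.ne'
  have hb := Int.emod_nonneg b hp.ne'
  have hc := Int.emod_nonneg c hp.ne'
  have ha' := Int.emod_lt_of_pos a hp
  have hb' := Int.emod_lt_of_pos b hp
  have hc' := Int.emod_lt_of_pos c hp
  have key : a % p + b % p + c % p = -(a / p + b / p + c / p) * p := by
    linear_combination habc + Int.emod_def a p + Int.emod_def b p + Int.emod_def c p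
  exact ⟨_, by nlinarith, by nlinarith, key⟩

theorem ediv_add_ediv_add_ediv_mem_Icc {p u v w m : ℤ} (hp : 0 < p) (huvw : u + v + w = m * p) :
    u / p + v / p + w / p ∈ Set.Icc (m - 2) m := by
  obtain ⟨k, hk0, hk3, hk⟩ :=
    exists_emod_add_emod_add_emod_eq_mul (a := u) (b := v) (c := w - m * p) hp (by linarith)
  rw [Int.sub_mul_emod_self_right] at hk
  have hsum : u / p + v / p + w / p = m - k := by
    apply mul_right_cancel₀ hp.ne'
    linear_combination huvw - hk + Int.emod_def u p + Int.emod_def v p + Int.emod_def w p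
  rw [hsum]
  constructor <;> omega

theorem base_hash_almost_linear (p ℓ : ℤ) (hp : 0 < p) (hℓ : 0 < ℓ) (r : ℤ)
    (h : ℤ → ℤ) (hh : ∀ t : ℤ, h t = ((r * t).emod p * ℓ).ediv p)
    (x y z : ℤ) (hxyz : x + y + z = 0) :
    h x + h y + h z ∈ ({0, ℓ - 2, ℓ - 1, ℓ, 2 * ℓ - 2, 2 * ℓ - 1, 2 * ℓ} : Set ℤ) := by
  have hh' (t : ℤ) : h t = r * t % p * ℓ / p := hh t
  have hnonneg (t : ℤ) : 0 ≤ h t := by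
    rw [hh']
    exact Int.ediv_nonneg (mul_nonneg (Int.emod_nonneg _ hp.ne') hℓ.le) hp.le
  obtain ⟨k, hk0, hk3, hk⟩ := exists_emod_add_emod_add_emod_eq_mul
    (a := r * x) (b := r * y) (c := r * z) hp (by linear_combination r * hxyz)
  obtain ⟨hlow, hupp⟩ := ediv_add_ediv_add_ediv_mem_Icc (m := k * ℓ) (u := r * x % p * ℓ)
    (v := r * y % p * ℓ) (w := r * z % p * ℓ) hp (by linear_combination ℓ * hk)
  rw [← hh', ← hh', ← hh'] at hlow hupp
  have hx := hnonneg x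
  have hy := hnonneg y
  have hz := hnonneg z
  simp only [Set.mem_insert_iff, Set.mem_singleton_iff]
  interval_cases k <;> omega
end

section
/- Let p be a prime, let ℓ be an integer with 2 ≤ ℓ < p, and let x, y be integers with x ≢ y (mod p). For each r ∈ {1, …, p−1} define h_r(t) = ⌊((r·t mod p) · ℓ) / p⌋. Then ℓ · |{r ∈ {1, …, p−1} : h_r(x) = h_r(y)}| ≤ 2(p − 1). -/
/-- Numbers with the same floor quotient by `p` differ by less than `p`. -/
theorem abs_sub_lt_of_ediv_eq {p a b : ℤ} (hp : 0 < p) (h : a / p = b / p) : |a - b| < p := by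
  have ha := Int.emod_add_mul_ediv a p
  have hb := Int.emod_add_mul_ediv b p
  have ha₀ := Int.emod_nonneg a hp.ne'
  have hb₀ := Int.emod_nonneg b hp.ne'
  have ha₁ := Int.emod_lt_of_pos a hp
  have hb₁ := Int.emod_lt_of_pos b hp
  rw [h] at ha
  rw [abs_lt]
  constructor <;> linarith

theorem card_Icc_neg_erase_zero {k : ℤ} (hk : 0 ≤ k) :
    (((Finset.Icc (-k) k).erase 0).card : ℤ) = 2 * k := by
  rw [Finset.card_erase_of_mem (by simp [hk]), Int.card_Icc]
  omega

/-- The difference of residues `r * x % p - r * y % p` is congruent to `r * (x - y)`. -/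
theorem mul_emod_sub_mul_emod_modEq (p r x y : ℤ) :
    r * x % p - r * y % p ≡ r * (x - y) [ZMOD p] := by
  rw [mul_sub]
  exact (Int.mod_modEq _ _).sub (Int.mod_modEq _ _)

theorem base_hash_almost_two_universal (p : ℕ) (hp : p.Prime) (ℓ : ℤ) (hℓ : 2 ≤ ℓ)
    (hℓp : ℓ < (p : ℤ)) (x y : ℤ) (hxy : ¬ ((p : ℤ) ∣ x - y))
    (h : ℤ → ℤ → ℤ) (hh : ∀ r t : ℤ, h r t = ((r * t).emod p * ℓ).ediv p) :
    ℓ * (((Finset.Icc (1 : ℤ) ((p : ℤ) - 1)).filter fun r => h r x = h r y).card : ℤ)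
      ≤ 2 * ((p : ℤ) - 1) := by
  have hp₀ : (0 : ℤ) < p := by exact_mod_cast hp.pos
  have hpp : Prime (p : ℤ) := Nat.prime_iff_prime_int.mp hp
  have hh' : ∀ r t : ℤ, h r t = r * t % p * ℓ / p := hh
  have hℓ₀ : 0 < ℓ := by linarith
  set k : ℤ := ((p : ℤ) - 1) / ℓ
  have hk : 0 ≤ k := Int.ediv_nonneg (by linarith) hℓ₀.le
  have hcard : ((Finset.Icc (1 : ℤ) ((p : ℤ) - 1)).filter fun r => h r x = h r y).card ≤
      ((Finset.Icc (-k) k).erase 0).card := by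
    refine Finset.card_le_card_of_injOn (fun r => r * x % p - r * y % p) ?_ ?_
    · intro r hr
      obtain ⟨hr, hcol⟩ := Finset.mem_filter.mp hr
      obtain ⟨hr₁, hr₂⟩ := Finset.mem_Icc.mp hr
      refine Finset.mem_erase.mpr ⟨fun h0 => ?_, Finset.mem_Icc.mpr (abs_le.mp ?_)⟩
      · have hdvd := mul_emod_sub_mul_emod_modEq p r x y
        rw [show r * x % p - r * y % p = 0 from h0] at hdvd
        rcases hpp.dvd_or_dvd (Int.modEq_zero_iff_dvd.mp hdvd.symm) with hd | hd
        · linarith [Int.le_of_dvd (by linarith) hd]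
        · exact hxy hd
      · rw [hh', hh'] at hcol
        have hlt := abs_sub_lt_of_ediv_eq hp₀ hcol
        rw [← sub_mul, abs_mul, abs_of_pos hℓ₀] at hlt
        exact (Int.le_ediv_iff_mul_le hℓ₀).mpr (by linarith)
    · intro r hr s hs hrs
      obtain ⟨hr₁, hr₂⟩ := Finset.mem_Icc.mp (Finset.mem_filter.mp hr).1
      obtain ⟨hs₁, hs₂⟩ := Finset.mem_Icc.mp (Finset.mem_filter.mp hs).1
      have hmod := mul_emod_sub_mul_emod_modEq p r x y
      rw [show r * x % p - r * y % p = s * x % p - s * y % p from hrs] at hmod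
      have hdvd := (hmod.symm.trans (mul_emod_sub_mul_emod_modEq p s x y)).symm.dvd
      rw [← sub_mul] at hdvd
      have hd := (hpp.dvd_or_dvd hdvd).resolve_right hxy
      exact sub_eq_zero.mp (Int.eq_zero_of_abs_lt_dvd hd (abs_lt.mpr ⟨by linarith, by linarith⟩))
  have hcard' : (((Finset.Icc (1 : ℤ) ((p : ℤ) - 1)).filter fun r => h r x = h r y).card : ℤ) ≤
      2 * k := by
    rw [← card_Icc_neg_erase_zero hk]
    exact_mod_cast hcard
  calc _ ≤ ℓ * (2 * k) := mul_le_mul_of_nonneg_left hcard' hℓ₀.le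
    _ ≤ 2 * ((p : ℤ) - 1) := by linarith [Int.mul_ediv_self_le (x := (p : ℤ) - 1) hℓ₀.ne']
end

section
/- Let ℓ ≥ 1 be an integer and let x, y, z be pairwise distinct integers. If x, y, z have no 3-term ℓ-relation, then ℓ · gcd(y − z, x − z) < 2 · max(|y − z|, |x − z|). -/
theorem no_relation_gcd_bound (ℓ : ℤ) (hℓ : 1 ≤ ℓ) (x y z : ℤ)
    (hxy : x ≠ y) (hyz : y ≠ z) (hxz : x ≠ z)
    (hrel : ¬ ∃ α β γ : ℤ, |α| ≤ ℓ ∧ |β| ≤ ℓ ∧ |γ| ≤ ℓ ∧ α + β + γ = 0 ∧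
      (α, β, γ) ≠ (0, 0, 0) ∧ α * x + β * y + γ * z = 0) :
    ℓ * (Int.gcd (y - z) (x - z) : ℤ) < 2 * max |y - z| |x - z| := by
  have hg : (0 : ℤ) < Int.gcd (y - z) (x - z) :=
    Int.natCast_pos.mpr (Int.gcd_pos_of_ne_zero_left _ (sub_ne_zero.mpr hyz))
  obtain ⟨a, ha⟩ := Int.gcd_dvd_left (y - z) (x - z)
  obtain ⟨b, hb⟩ := Int.gcd_dvd_right (y - z) (x - z)
  generalize (Int.gcd (y - z) (x - z) : ℤ) = g at *
  by_contra! h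
  have bound (t s : ℤ) (hs : s = g * t) (hle : |s| ≤ max |y - z| |x - z|) : 2 * |t| ≤ ℓ := by
    refine le_of_mul_le_mul_right ?_ hg
    rw [hs, abs_mul, abs_of_pos hg] at hle
    linarith
  have h_a := bound a _ ha (le_max_left _ _)
  have h_b := bound b _ hb (le_max_right _ _)
  have ha0 : a ≠ 0 := by
    rintro rfl
    exact hyz (by linarith)
  have hsub := abs_sub b a
  refine hrel ⟨a, -b, b - a, ?_, ?_, ?_, by ring, by simp [ha0], ?_⟩
  · linarith [abs_nonneg a]
  · linarith [abs_nonneg b, abs_neg b]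
  · linarith
  · linear_combination a * hb - b * ha
end

section
/- There exists a constant C > 0 such that for every integer U ≥ 2 the following holds: set ℓ = ⌈exp((log U)^{1/3})⌉; then every set A ⊆ ℤ ∩ [0, U] can be partitioned into at most ⌈exp(C·(log U)^{2/3})⌉ disjoint subsets, each of which contains no nontrivial 3-term ℓ-relation. -/
/-- The set `B` contains a nontrivial 3-term `ℓ`-relation: there are `x, y, z ∈ B`
(not necessarily distinct) and coefficients `α, β, γ` of magnitude at most `ℓ`
summing to `0` with `α·x + β·y + γ·z = 0`, such that the solution is nontrivial,
i.e. it is not the case that for every value `v ∈ {x, y, z}` the coefficients of the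
variables equal to `v` sum to zero. -/
def HasNontrivial3TermRel (ℓ : ℤ) (B : Finset ℤ) : Prop :=
  ∃ x ∈ B, ∃ y ∈ B, ∃ z ∈ B, ∃ α β γ : ℤ,
    |α| ≤ ℓ ∧ |β| ≤ ℓ ∧ |γ| ≤ ℓ ∧ α + β + γ = 0 ∧ α * x + β * y + γ * z = 0 ∧
    ¬ (∀ v ∈ ({x, y, z} : Set ℤ),
        (if x = v then α else 0) + (if y = v then β else 0) + (if z = v then γ else 0) = 0)

theorem Finset.exists_partition_of_mapsTo {α T : Type*} [DecidableEq α] [DecidableEq T]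
    (A : Finset α) (s : Finset T) (f : α → T) (hf : ∀ a ∈ A, f a ∈ s) :
    ∃ P : Fin s.card → Finset α,
      (∀ i j, i ≠ j → Disjoint (P i) (P j)) ∧ Finset.univ.biUnion P = A ∧
      ∀ i, P i ⊆ A ∧ ∀ x ∈ P i, ∀ y ∈ P i, f x = f y := by
  refine ⟨fun i => A.filter fun a => f a = (s.equivFin.symm i : T), ?_, ?_, ?_⟩
  · intro i j hij
    rw [Finset.disjoint_left]
    intro a hi hj
    rw [Finset.mem_filter] at hi hj
    exact hij (s.equivFin.symm.injective (Subtype.ext (hi.2.symm.trans hj.2)))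
  · ext a
    simp only [Finset.mem_biUnion, Finset.mem_univ, true_and, Finset.mem_filter]
    refine ⟨fun ⟨_, h, _⟩ => h, fun h => ⟨s.equivFin ⟨f a, hf a h⟩, h, ?_⟩⟩
    simp
  · refine fun i => ⟨Finset.filter_subset _ _, fun x hx y hy => ?_⟩
    rw [Finset.mem_filter] at hx hy
    exact hx.2.trans hy.2.symm

theorem not_hasNontrivial3TermRel_of_convex {ℓ : ℤ} {B : Finset ℤ}
    (h : ∀ x ∈ B, ∀ y ∈ B, ∀ z ∈ B, ∀ b c : ℤ, 0 < b → 0 < c → b + c ≤ ℓ →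
      b * x + c * y = (b + c) * z → x = y) :
    ¬ HasNontrivial3TermRel ℓ B := by
  have key : ∀ x ∈ B, ∀ y ∈ B, ∀ z ∈ B, ∀ α β γ : ℤ, |γ| ≤ ℓ → α + β + γ = 0 →
      α * x + β * y + γ * z = 0 → (0 < α ∧ 0 < β ∨ α < 0 ∧ β < 0) → x = y ∧ z = y := by
    intro x hx y hy z hz α β γ hγ hsum hrel hsign
    obtain rfl : γ = -(α + β) := by linarith
    rw [abs_le] at hγ
    have hxy : x = y := by
      rcases hsign with ⟨hα, hβ⟩ | ⟨hα, hβ⟩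
      · exact h x hx y hy z hz α β hα hβ (by linarith) (by linarith)
      · exact h x hx y hy z hz (-α) (-β) (by linarith) (by linarith) (by linarith) (by linarith)
    subst hxy
    have hne : α + β ≠ 0 := by omega
    exact ⟨rfl, mul_left_cancel₀ hne (by linarith)⟩
  rintro ⟨x, hx, y, hy, z, hz, α, β, γ, hα, hβ, hγ, hsum, hrel, hnon⟩
  apply hnon
  intro v _
  rcases eq_or_ne α 0 with rfl | hα0
  · obtain rfl : γ = -β := by linarith
    rcases mul_eq_zero.1 (show β * (y - z) = 0 by linarith) with h0 | h0
    · simp [h0]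
    · rw [sub_eq_zero.1 h0]
      split_ifs <;> simp
  rcases eq_or_ne β 0 with rfl | hβ0
  · obtain rfl : γ = -α := by linarith
    rcases mul_eq_zero.1 (show α * (x - z) = 0 by linarith) with h0 | h0
    · simp [h0]
    · rw [sub_eq_zero.1 h0]
      split_ifs <;> simp
  rcases eq_or_ne γ 0 with rfl | hγ0
  · obtain rfl : β = -α := by linarith
    rcases mul_eq_zero.1 (show α * (x - y) = 0 by linarith) with h0 | h0
    · simp [h0]
    · rw [sub_eq_zero.1 h0]
      split_ifs <;> simp
  have hall : x = y ∧ z = y := by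
    have hcases : (0 < α ∧ 0 < β ∨ α < 0 ∧ β < 0) ∨ (0 < α ∧ 0 < γ ∨ α < 0 ∧ γ < 0) ∨
        (0 < β ∧ 0 < γ ∨ β < 0 ∧ γ < 0) := by omega
    rcases hcases with hs | hs | hs
    · exact key x hx y hy z hz α β γ hγ hsum hrel hs
    · have := key x hx z hz y hy α γ β hβ (by linarith) (by linarith) hs
      omega
    · have := key y hy z hz x hx β γ α hα (by linarith) (by linarith) hs
      omega
  obtain ⟨rfl, rfl⟩ := hall
  split_ifs <;> simp [hsum]

theorem Int.sum_ediv_emod_mul_pow_add {D : ℤ} (hD : 0 ≤ D) (n : ℤ) (k : ℕ) :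
    ∑ i ∈ Finset.range k, n / D ^ i % D * D ^ i + n / D ^ k * D ^ k = n := by
  induction k with
  | zero => simp
  | succ k ih =>
    have hdiv : n / D ^ (k + 1) = n / D ^ k / D := by
      rw [pow_succ, Int.ediv_ediv_of_nonneg (pow_nonneg hD k)]
    have := Int.emod_add_mul_ediv (n / D ^ k) D
    rw [Finset.sum_range_succ, hdiv, pow_succ]
    linear_combination ih + D ^ k * this

theorem Int.eq_zero_of_sum_mul_pow_eq_zero {D : ℤ} (k : ℕ) (e : ℕ → ℤ)
    (he : ∀ i < k, |e i| < D) (h : ∑ i ∈ Finset.range k, e i * D ^ i = 0) :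
    ∀ i < k, e i = 0 := by
  induction k generalizing e with
  | zero => intro i hi; omega
  | succ k ih =>
    have hD : D ≠ 0 := ((abs_nonneg _).trans_lt (he 0 (by omega))).ne'
    have hsplit : D * ∑ i ∈ Finset.range k, e (i + 1) * D ^ i + e 0 = 0 := by
      rw [← h, Finset.sum_range_succ', Finset.mul_sum]
      congr 1
      · exact Finset.sum_congr rfl fun i _ => by ring
      · simp
    have h0 : e 0 = 0 := by
      refine Int.eq_zero_of_abs_lt_dvd (m := D)
        ⟨-∑ i ∈ Finset.range k, e (i + 1) * D ^ i, by linarith⟩ (he 0 (by omega))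
    rw [h0, add_zero] at hsplit
    have := ih (fun i => e (i + 1)) (fun i hi => he (i + 1) (by omega))
      ((mul_eq_zero.1 hsplit).resolve_left hD)
    rintro (_ | i) hi
    · exact h0
    · exact this i (by omega)

theorem eq_of_convex_of_sum_sq_eq {ι : Type*} (s : Finset ι) (u v w : ι → ℤ) {b c : ℤ}
    (hb : 0 < b) (hc : 0 < c) (h : ∀ i ∈ s, b * u i + c * v i = (b + c) * w i)
    (huv : ∑ i ∈ s, u i ^ 2 = ∑ i ∈ s, v i ^ 2) (hvw : ∑ i ∈ s, v i ^ 2 = ∑ i ∈ s, w i ^ 2) :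
    ∀ i ∈ s, u i = v i := by
  have hid : b * c * ∑ i ∈ s, (u i - v i) ^ 2 =
      (b + c) * (b * ∑ i ∈ s, u i ^ 2 + c * ∑ i ∈ s, v i ^ 2) -
        (b + c) ^ 2 * ∑ i ∈ s, w i ^ 2 := by
    simp only [Finset.mul_sum, ← Finset.sum_add_distrib, ← Finset.sum_sub_distrib]
    refine Finset.sum_congr rfl fun i hi => ?_
    linear_combination (-(b * u i + c * v i) - (b + c) * w i) * h i hi
  have hz : b * c * ∑ i ∈ s, (u i - v i) ^ 2 = 0 := by
    rw [hid, huv, hvw]; ring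
  have hsum := (mul_eq_zero.1 hz).resolve_left (mul_pos hb hc).ne'
  rw [Finset.sum_eq_zero_iff_of_nonneg fun i _ => sq_nonneg _] at hsum
  exact fun i hi => sub_eq_zero.1 (pow_eq_zero_iff two_ne_zero |>.1 (hsum i hi))

theorem eq_of_convex_of_digits {ℓ q : ℤ} (hℓ : 0 ≤ ℓ) (hq : 0 < q) {k : ℕ} {x y z b c : ℤ}
    (hx : x / (ℓ * q) ^ k = 0) (hy : y / (ℓ * q) ^ k = 0) (hz : z / (ℓ * q) ^ k = 0)
    (hxy : ∀ i < k, x / (ℓ * q) ^ i % (ℓ * q) / q = y / (ℓ * q) ^ i % (ℓ * q) / q)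
    (hyz : ∀ i < k, y / (ℓ * q) ^ i % (ℓ * q) / q = z / (ℓ * q) ^ i % (ℓ * q) / q)
    (hsxy : ∑ i ∈ Finset.range k, (x / (ℓ * q) ^ i % (ℓ * q) % q) ^ 2 =
      ∑ i ∈ Finset.range k, (y / (ℓ * q) ^ i % (ℓ * q) % q) ^ 2)
    (hsyz : ∑ i ∈ Finset.range k, (y / (ℓ * q) ^ i % (ℓ * q) % q) ^ 2 =
      ∑ i ∈ Finset.range k, (z / (ℓ * q) ^ i % (ℓ * q) % q) ^ 2)
    (hb : 0 < b) (hc : 0 < c) (hbc : b + c ≤ ℓ) (h : b * x + c * y = (b + c) * z) : x = y := by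
  have hD : 0 ≤ ℓ * q := mul_nonneg hℓ hq.le
  set D := ℓ * q
  have hxs := Int.sum_ediv_emod_mul_pow_add hD x k
  have hys := Int.sum_ediv_emod_mul_pow_add hD y k
  have hzs := Int.sum_ediv_emod_mul_pow_add hD z k
  rw [hx, zero_mul, add_zero] at hxs
  rw [hy, zero_mul, add_zero] at hys
  rw [hz, zero_mul, add_zero] at hzs
  have hlow : ∀ i < k, b * (x / D ^ i % D % q) + c * (y / D ^ i % D % q)
      - (b + c) * (z / D ^ i % D % q) = 0 := by
    refine Int.eq_zero_of_sum_mul_pow_eq_zero (D := D) k _ (fun i _ => ?_) ?_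
    · have hu := Int.emod_nonneg (x / D ^ i % D) hq.ne'
      have hv := Int.emod_nonneg (y / D ^ i % D) hq.ne'
      have hw := Int.emod_nonneg (z / D ^ i % D) hq.ne'
      have hu' := Int.emod_lt_of_pos (x / D ^ i % D) hq
      have hv' := Int.emod_lt_of_pos (y / D ^ i % D) hq
      have hw' := Int.emod_lt_of_pos (z / D ^ i % D) hq
      have hD : (b + c) * q ≤ D := mul_le_mul_of_nonneg_right hbc hq.le
      rw [abs_lt]
      constructor <;> nlinarith
    · have : b * x + c * y - (b + c) * z = 0 := by linarith
      rw [← this]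
      conv_rhs => rw [← hxs, ← hys, ← hzs]
      simp only [Finset.mul_sum, ← Finset.sum_add_distrib, ← Finset.sum_sub_distrib]
      refine Finset.sum_congr rfl fun i hi => ?_
      have hi := Finset.mem_range.1 hi
      have h1 := Int.emod_add_mul_ediv (x / D ^ i % D) q
      have h2 := Int.emod_add_mul_ediv (y / D ^ i % D) q
      have h3 := Int.emod_add_mul_ediv (z / D ^ i % D) q
      rw [hxy i hi] at h1
      rw [← hyz i hi] at h3
      linear_combination b * D ^ i * h1 + c * D ^ i * h2 - (b + c) * D ^ i * h3
  have heq := eq_of_convex_of_sum_sq_eq (Finset.range k) _ _ _ hb hc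
    (fun i hi => sub_eq_zero.1 (hlow i (Finset.mem_range.1 hi))) hsxy hsyz
  rw [← hxs, ← hys]
  refine Finset.sum_congr rfl fun i hi => ?_
  rw [← Int.emod_add_mul_ediv (x / D ^ i % D) q, heq i hi, hxy i (Finset.mem_range.1 hi),
    Int.emod_add_mul_ediv]

theorem exists_partition_not_hasNontrivial3TermRel (ℓ q k : ℕ) (hℓ : 0 < ℓ) (hq : 0 < q)
    (A : Finset ℤ) (hA : ∀ a ∈ A, 0 ≤ a ∧ a < ((ℓ : ℤ) * q) ^ k) :
    ∃ P : Fin (ℓ ^ k * (k * q ^ 2 + 1)) → Finset ℤ,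
      (∀ i j, i ≠ j → Disjoint (P i) (P j)) ∧ Finset.univ.biUnion P = A ∧
      ∀ i, ¬ HasNontrivial3TermRel ℓ (P i) := by
  have hq' : (0 : ℤ) < q := by exact_mod_cast hq
  have hD : (0 : ℤ) < (ℓ : ℤ) * q := by positivity
  let s : Finset ((Fin k → ℤ) × ℤ) :=
    Fintype.piFinset (fun _ => Finset.Ico (0 : ℤ) ℓ) ×ˢ Finset.Ico (0 : ℤ) (k * q ^ 2 + 1 : ℕ)
  let f : ℤ → (Fin k → ℤ) × ℤ := fun x =>
    (fun i => x / ((ℓ : ℤ) * q) ^ (i : ℕ) % (ℓ * q) / q,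
      ∑ i ∈ Finset.range k, (x / ((ℓ : ℤ) * q) ^ i % (ℓ * q) % q) ^ 2)
  have hs : s.card = ℓ ^ k * (k * q ^ 2 + 1) := by
    simp only [s, Finset.card_product, Fintype.card_piFinset, Int.card_Ico, sub_zero,
      Int.toNat_natCast, Finset.prod_const, Finset.card_univ, Fintype.card_fin]
  have hf : ∀ a ∈ A, f a ∈ s := by
    intro a _
    simp only [s, f, Finset.mem_product, Fintype.mem_piFinset, Finset.mem_Ico]
    refine ⟨fun i => ⟨Int.ediv_nonneg (Int.emod_nonneg _ hD.ne') hq'.le,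
      Int.ediv_lt_of_lt_mul hq' (Int.emod_lt_of_pos _ hD)⟩,
      Finset.sum_nonneg fun i _ => sq_nonneg _, ?_⟩
    have : ∑ i ∈ Finset.range k, (a / ((ℓ : ℤ) * q) ^ i % (ℓ * q) % q) ^ 2 ≤
        ∑ i ∈ Finset.range k, (q : ℤ) ^ 2 :=
      Finset.sum_le_sum fun i _ => pow_le_pow_left₀ (Int.emod_nonneg _ hq'.ne')
        (Int.emod_lt_of_pos _ hq').le 2
    simp only [Finset.sum_const, Finset.card_range, nsmul_eq_mul] at this
    push_cast
    linarith
  obtain ⟨P, hdisj, hunion, hP⟩ := Finset.exists_partition_of_mapsTo A s f hf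
  rw [← hs]
  refine ⟨P, hdisj, hunion, fun i => not_hasNontrivial3TermRel_of_convex ?_⟩
  intro x hx y hy z hz b c hb hc hbc h
  have hdiv : ∀ a ∈ P i, a / ((ℓ : ℤ) * q) ^ k = 0 := fun a ha =>
    Int.ediv_eq_zero_of_lt (hA a ((hP i).1 ha)).1 (hA a ((hP i).1 ha)).2
  have hxy := Prod.ext_iff.1 ((hP i).2 x hx y hy)
  have hyz := Prod.ext_iff.1 ((hP i).2 y hy z hz)
  exact eq_of_convex_of_digits (Int.natCast_nonneg ℓ) hq' (hdiv x hx) (hdiv y hy) (hdiv z hz)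
    (fun j hj => congrFun hxy.1 ⟨j, hj⟩) (fun j hj => congrFun hyz.1 ⟨j, hj⟩) hxy.2 hyz.2
    hb hc hbc h

theorem Nat.ceil_exp_le_exp_add_one {t : ℝ} (ht : 0 ≤ t) :
    (⌈Real.exp t⌉₊ : ℝ) ≤ Real.exp (t + 1) := by
  have h1 := (Nat.ceil_lt_add_one (Real.exp_pos t).le).le
  have h2 := Real.add_one_le_exp (1 : ℝ)
  have h3 := Real.one_le_exp ht
  rw [Real.exp_add]
  nlinarith

theorem card_colors_le_exp {t : ℝ} (ht : 1 / 2 ≤ t) :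
    ((⌈Real.exp t⌉₊ ^ ⌈t⌉₊ * (⌈t⌉₊ * ⌈Real.exp (t ^ 2)⌉₊ ^ 2 + 1) : ℕ) : ℝ) ≤
      Real.exp (25 * t ^ 2) := by
  have hk : (⌈t⌉₊ : ℝ) ≤ 3 * t := by
    have := Nat.ceil_lt_add_one (show 0 ≤ t by linarith)
    linarith
  have hℓ : (⌈Real.exp t⌉₊ : ℝ) ^ ⌈t⌉₊ ≤ Real.exp (9 * t ^ 2) := by
    calc (⌈Real.exp t⌉₊ : ℝ) ^ ⌈t⌉₊ ≤ Real.exp (t + 1) ^ ⌈t⌉₊ :=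
          pow_le_pow_left₀ (by positivity) (Nat.ceil_exp_le_exp_add_one (by linarith)) _
      _ = Real.exp (⌈t⌉₊ * (t + 1)) := (Real.exp_nat_mul _ _).symm
      _ ≤ Real.exp (9 * t ^ 2) := Real.exp_le_exp.2 (by nlinarith)
  have hq : (⌈Real.exp (t ^ 2)⌉₊ : ℝ) ^ 2 ≤ Real.exp (10 * t ^ 2) := by
    calc (⌈Real.exp (t ^ 2)⌉₊ : ℝ) ^ 2 ≤ Real.exp (t ^ 2 + 1) ^ 2 :=
          pow_le_pow_left₀ (by positivity) (Nat.ceil_exp_le_exp_add_one (by positivity)) _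
      _ = Real.exp ((2 : ℕ) * (t ^ 2 + 1)) := (Real.exp_nat_mul _ _).symm
      _ ≤ Real.exp (10 * t ^ 2) := Real.exp_le_exp.2 (by push_cast; nlinarith)
  have hk' : (⌈t⌉₊ : ℝ) + 1 ≤ Real.exp (6 * t ^ 2) := by
    have := Real.add_one_le_exp (6 * t ^ 2)
    nlinarith
  have h1 : 1 ≤ Real.exp (10 * t ^ 2) := Real.one_le_exp (by positivity)
  push_cast
  calc (⌈Real.exp t⌉₊ : ℝ) ^ ⌈t⌉₊ * (⌈t⌉₊ * (⌈Real.exp (t ^ 2)⌉₊ : ℝ) ^ 2 + 1)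
      ≤ Real.exp (9 * t ^ 2) * (⌈t⌉₊ * Real.exp (10 * t ^ 2) + Real.exp (10 * t ^ 2)) := by
        gcongr
    _ = Real.exp (9 * t ^ 2) * ((⌈t⌉₊ + 1) * Real.exp (10 * t ^ 2)) := by ring
    _ ≤ Real.exp (9 * t ^ 2) * (Real.exp (6 * t ^ 2) * Real.exp (10 * t ^ 2)) := by gcongr
    _ = Real.exp (25 * t ^ 2) := by rw [← Real.exp_add, ← Real.exp_add]; ring_nf

theorem lt_ceil_exp_mul_ceil_exp_pow {t : ℝ} (ht : 0 < t) :
    Real.exp (t ^ 3) < ((⌈Real.exp t⌉₊ : ℝ) * ⌈Real.exp (t ^ 2)⌉₊) ^ ⌈t⌉₊ := by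
  calc Real.exp (t ^ 3) < Real.exp (⌈t⌉₊ * (t + t ^ 2)) := by
        have := Nat.le_ceil t
        refine Real.exp_lt_exp.2 ?_
        calc t ^ 3 < t * (t + t ^ 2) := by nlinarith [sq_pos_of_pos ht]
          _ ≤ ⌈t⌉₊ * (t + t ^ 2) := by gcongr
    _ = (Real.exp t * Real.exp (t ^ 2)) ^ ⌈t⌉₊ := by rw [Real.exp_nat_mul, Real.exp_add]
    _ ≤ _ := by gcongr <;> exact Nat.le_ceil _

theorem behrend_partition :
    ∃ C : ℝ, 0 < C ∧ ∀ U : ℕ, 2 ≤ U →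
      ∀ A : Finset ℤ, A ⊆ Finset.Icc 0 (U : ℤ) →
        ∃ (b : ℕ) (P : Fin b → Finset ℤ),
          b ≤ ⌈Real.exp (C * Real.log U ^ ((2 : ℝ) / 3))⌉₊ ∧
          (∀ i j, i ≠ j → Disjoint (P i) (P j)) ∧
          Finset.univ.biUnion P = A ∧
          ∀ i, ¬ HasNontrivial3TermRel (⌈Real.exp (Real.log U ^ ((1 : ℝ) / 3))⌉₊ : ℤ) (P i) := by
  refine ⟨25, by norm_num, fun U hU A hA => ?_⟩
  set t : ℝ := Real.log U ^ ((1 : ℝ) / 3) with ht_def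
  have hU' : (2 : ℝ) ≤ U := by exact_mod_cast hU
  have hlog : 1 / 2 < Real.log U := by
    have h1 := Real.log_two_gt_d9
    have h2 := Real.log_le_log (by norm_num) hU'
    linarith
  have ht3 : t ^ 3 = Real.log U := by
    rw [ht_def, ← Real.rpow_natCast, ← Real.rpow_mul (by linarith)]
    norm_num
  have ht2 : Real.log U ^ ((2 : ℝ) / 3) = t ^ 2 := by
    rw [ht_def, ← Real.rpow_natCast, ← Real.rpow_mul (by linarith)]
    norm_num
  have ht : 1 / 2 ≤ t := by
    have ht0 : 0 ≤ t := Real.rpow_nonneg (by linarith) _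
    by_contra! hlt
    have := pow_le_pow_left₀ ht0 hlt.le 3
    linarith
  obtain ⟨P, hdisj, hunion, hP⟩ := exists_partition_not_hasNontrivial3TermRel
    ⌈Real.exp t⌉₊ ⌈Real.exp (t ^ 2)⌉₊ ⌈t⌉₊ (Nat.ceil_pos.2 (Real.exp_pos _))
    (Nat.ceil_pos.2 (Real.exp_pos _)) A (by
      intro a ha
      obtain ⟨h0, haU⟩ := Finset.mem_Icc.1 (hA ha)
      refine ⟨h0, haU.trans_lt ?_⟩
      have := lt_ceil_exp_mul_ceil_exp_pow (show 0 < t by linarith)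
      rw [ht3, Real.exp_log (by linarith)] at this
      exact_mod_cast this)
  refine ⟨_, P, ?_, hdisj, hunion, hP⟩
  rw [ht2]
  exact_mod_cast (card_colors_le_exp ht).trans (Nat.le_ceil _)
end

section
/- Let G be a simple graph on a finite vertex set in which every vertex has degree at most d, let A be its adjacency matrix over ℝ, and for each j let C_j = tr(A^j) be the number of closed j-step walks in G. Then for every integer k ≥ 4, C_k ≤ C_4 · d^{k−4}. -/
/-- The trace of a power of a Hermitian matrix is the corresponding power sum of its eigenvalues. -/
theorem Matrix.IsHermitian.trace_pow_eq_sum_eigenvalues_pow {𝕜 n : Type*} [RCLike 𝕜] [Fintype n]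
    [DecidableEq n] {A : Matrix n n 𝕜} (hA : A.IsHermitian) (k : ℕ) :
    Matrix.trace (A ^ k) = ∑ i, (hA.eigenvalues i : 𝕜) ^ k := by
  conv_lhs => rw [hA.spectral_theorem, ← map_pow, Unitary.conjStarAlgAut_apply,
    Matrix.trace_mul_cycle, Unitary.coe_star_mul_self, one_mul, Matrix.diagonal_pow]
  simp [Matrix.trace_diagonal]

/-- Every eigenvalue of the adjacency matrix is at most the maximum degree in absolute value. -/
theorem SimpleGraph.abs_eigenvalue_adjMatrix_le {V : Type*} [Fintype V] [DecidableEq V]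
    (G : SimpleGraph V) [DecidableRel G.Adj] {d : ℕ} (hd : ∀ v : V, G.degree v ≤ d) {μ : ℝ}
    (hμ : Module.End.HasEigenvalue (Matrix.toLin' (G.adjMatrix ℝ)) μ) : |μ| ≤ d := by
  obtain ⟨v, hv⟩ := eigenvalue_mem_ball hμ
  have hrow : ∑ w ∈ Finset.univ.erase v, ‖G.adjMatrix ℝ v w‖ ≤ G.degree v := by
    calc ∑ w ∈ Finset.univ.erase v, ‖G.adjMatrix ℝ v w‖
        ≤ ∑ w, ‖G.adjMatrix ℝ v w‖ :=
          Finset.sum_le_sum_of_subset_of_nonneg (Finset.erase_subset _ _)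
            fun _ _ _ => norm_nonneg _
      _ = G.degree v := by
          simp [SimpleGraph.adjMatrix_apply, apply_ite, ← SimpleGraph.card_neighborFinset_eq_degree,
            SimpleGraph.neighborFinset_eq_filter]
  have hμv : |μ| ≤ ∑ w ∈ Finset.univ.erase v, ‖G.adjMatrix ℝ v w‖ := by
    simpa [Real.norm_eq_abs] using hv
  exact hμv.trans (hrow.trans (Nat.cast_le.mpr (hd v)))

theorem closed_walks_bound {V : Type*} [Fintype V] [DecidableEq V]
    (G : SimpleGraph V) [DecidableRel G.Adj] (d : ℕ) (hd : ∀ v : V, G.degree v ≤ d)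
    (k : ℕ) (hk : 4 ≤ k) :
    Matrix.trace ((G.adjMatrix ℝ) ^ k) ≤ Matrix.trace ((G.adjMatrix ℝ) ^ 4) * (d : ℝ) ^ (k - 4) := by
  have hA : (G.adjMatrix ℝ).IsHermitian := by
    rw [Matrix.IsHermitian, Matrix.conjTranspose_eq_transpose_of_trivial, G.transpose_adjMatrix]
  rw [hA.trace_pow_eq_sum_eigenvalues_pow, hA.trace_pow_eq_sum_eigenvalues_pow, Finset.sum_mul]
  refine Finset.sum_le_sum fun i _ => ?_
  have hμ : |hA.eigenvalues i| ≤ d := by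
    refine G.abs_eigenvalue_adjMatrix_le hd (Module.End.hasEigenvalue_iff_mem_spectrum.mpr ?_)
    rw [Matrix.spectrum_toLin']
    exact hA.eigenvalues_mem_spectrum_real i
  simp only [RCLike.ofReal_real_eq_id, id_eq]
  calc hA.eigenvalues i ^ k = hA.eigenvalues i ^ 4 * hA.eigenvalues i ^ (k - 4) := by
        rw [← pow_add, Nat.add_sub_cancel' hk]
    _ ≤ hA.eigenvalues i ^ 4 * (d : ℝ) ^ (k - 4) := by
        refine mul_le_mul_of_nonneg_left ?_ (by positivity)
        exact (le_abs_self _).trans (by rw [abs_pow]; gcongr)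
end

section
/- There exist constants c > 0 and C > 0 such that the following holds: for every finite set A ⊆ ℤ with |A| = n ≥ 1 and every real K ≥ 1, if E(A) ≥ n³/K, then there exists a subset A' ⊆ A with |A'| ≥ c·n/K² and |A' + A'| ≤ C·n·K^{28}. -/
open Pointwise

open Finset in
/-- The additive energy is Mathlib's `Finset.addEnergy`, written as a sum of squares. -/
theorem additiveEnergy_eq_sum_sq (A : Finset ℤ) :
    additiveEnergy A = ∑ s ∈ A + A, #{p ∈ A ×ˢ A | p.1 + p.2 = s} ^ 2 := by
  rw [← addEnergy_eq_sum_sq', additiveEnergy, addEnergy]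
  refine card_nbij' (fun t => ((t.1, t.2.2.1), (t.2.1, t.2.2.2)))
    (fun t => (t.1.1, t.2.1, t.1.2, t.2.2)) ?_ ?_ ?_ ?_
  · rintro ⟨a, b, c, d⟩
    simp only [coe_filter, mem_product, Set.mem_ofPred_eq]
    tauto
  · rintro ⟨⟨a, b⟩, c, d⟩
    simp only [coe_filter, mem_product, Set.mem_ofPred_eq]
    tauto
  · intro t _
    rfl
  · intro t _
    rfl

open Finset in
/-- A set of large additive energy has a small set `S` of sums attained by many pairs. -/
theorem exists_popular_sums (A : Finset ℤ) (hA : A.Nonempty) {K : ℝ} (hK : 1 ≤ K)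
    (hE : (#A : ℝ) ^ 3 / K ≤ additiveEnergy A) :
    ∃ S : Finset ℤ, (#S : ℝ) ≤ 2 * K * #A ∧
      (#A : ℝ) ^ 2 / (2 * K) ≤ ∑ y ∈ A, (#{a ∈ A | a + y ∈ S} : ℝ) := by
  have hK0 : 0 < K := by linarith
  have hn : (0 : ℝ) < #A := by exact_mod_cast hA.card_pos
  set r : ℤ → ℝ := fun s => (#{p ∈ A ×ˢ A | p.1 + p.2 = s} : ℝ) with hr
  have hr0 : ∀ s, 0 ≤ r s := fun s => Nat.cast_nonneg _
  have hrn : ∀ s, r s ≤ #A := by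
    intro s
    simp only [hr]
    norm_cast
    refine card_le_card_of_injOn Prod.fst ?_ ?_
    · rintro ⟨a, b⟩ h
      simp only [coe_filter, mem_product, Set.mem_ofPred_eq] at h
      exact h.1.1
    · rintro ⟨a, b⟩ h ⟨a', b'⟩ h' e
      simp only [coe_filter, mem_product, Set.mem_ofPred_eq] at h h' e
      ext <;> simp only <;> omega
  have hsum : ∑ s ∈ A + A, r s = (#A : ℝ) ^ 2 := by
    have h := card_eq_sum_card_fiberwise (f := fun p : ℤ × ℤ => p.1 + p.2) (s := A ×ˢ A)
      (t := A + A) (by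
        rintro ⟨a, b⟩ h
        simp only [coe_product, Set.mem_prod, mem_coe] at h
        exact_mod_cast add_mem_add h.1 h.2)
    rw [card_product] at h
    simp only [hr]
    rw [sq]
    exact_mod_cast h.symm
  have hsq : (#A : ℝ) ^ 3 / K ≤ ∑ s ∈ A + A, r s ^ 2 := by
    rw [additiveEnergy_eq_sum_sq] at hE
    push_cast at hE
    exact hE
  set t : ℝ := #A / (2 * K) with ht
  have ht0 : 0 < t := by positivity
  set S : Finset ℤ := {s ∈ A + A | t ≤ r s} with hS
  refine ⟨S, ?_, ?_⟩
  · have h1 : (#S : ℝ) * t ≤ (#A : ℝ) ^ 2 := by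
      rw [← hsum, ← nsmul_eq_mul]
      refine (card_nsmul_le_sum S r t fun s hs => (mem_filter.1 hs).2).trans ?_
      exact sum_le_sum_of_subset_of_nonneg (filter_subset _ _) fun s _ _ => hr0 s
    have h2 : (2 * K * #A) * t = (#A : ℝ) ^ 2 := by
      rw [ht]; field_simp
    exact le_of_mul_le_mul_right (h1.trans h2.ge) ht0
  · have hcount : ∑ y ∈ A, (#{a ∈ A | a + y ∈ S} : ℝ) = ∑ s ∈ S, r s := by
      have h := sum_card_fiberwise_eq_card_filter (A ×ˢ A) S fun p => p.1 + p.2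
      have h2 : #{p ∈ A ×ˢ A | p.1 + p.2 ∈ S} = ∑ y ∈ A, #{a ∈ A | a + y ∈ S} := by
        simp only [card_filter]
        rw [sum_product_right]
      rw [h2] at h
      simp only [hr]
      exact_mod_cast h.symm
    rw [hcount]
    have hle : ∑ s ∈ A + A, r s ^ 2 ≤ #A * ∑ s ∈ S, r s + t * ∑ s ∈ A + A, r s := by
      rw [← sum_filter_add_sum_filter_not (A + A) (fun s => t ≤ r s), mul_sum]
      refine add_le_add (sum_le_sum fun s _ => ?_) ?_
      · rw [sq]
        exact mul_le_mul_of_nonneg_right (hrn s) (hr0 s)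
      · rw [mul_sum]
        refine le_trans (sum_le_sum (g := fun s => t * r s) fun s hs => ?_)
          (sum_le_sum_of_subset_of_nonneg (filter_subset _ _)
            fun s _ _ => mul_nonneg ht0.le (hr0 s))
        have := (mem_filter.1 hs).2
        rw [sq]
        exact mul_le_mul_of_nonneg_right (not_le.1 this).le (hr0 s)
    rw [hsum] at hle
    have h1 : (#A : ℝ) ^ 3 / K = 2 * (t * (#A : ℝ) ^ 2) := by
      rw [ht]; field_simp
    have h2 : (#A : ℝ) * ((#A : ℝ) ^ 2 / (2 * K)) = t * (#A : ℝ) ^ 2 := by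
      rw [ht]; field_simp
    refine le_of_mul_le_mul_left ?_ hn
    linarith

open Finset Classical in
/-- Dependent random choice: a dense relation on `A` has a large set `X ⊆ A` and a large
`X' ⊆ X` any two of whose elements are joined by many paths of length four with midpoint in `X`. -/
theorem exists_subset_many_paths {V : Type*} (A : Finset V) (R : V → V → Prop) {α : ℝ}
    (hA : A.Nonempty) (hα : 0 < α)
    (hR : α * (#A : ℝ) ^ 2 ≤ ∑ y ∈ A, (#{a ∈ A | R a y} : ℝ)) :
    ∃ X ⊆ A, ∃ X' ⊆ X, α * #A / 2 ≤ #X ∧ 3 / 4 * (#X : ℝ) ≤ #X' ∧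
      ∀ a ∈ X', ∀ b ∈ X', (#X : ℝ) / 2 ≤
        #{x ∈ X | α ^ 2 / 32 * #A ≤ #{y ∈ A | R a y ∧ R x y} ∧
          α ^ 2 / 32 * #A ≤ #{y ∈ A | R b y ∧ R x y}} := by
  have hn : (0 : ℝ) < #A := by exact_mod_cast hA.card_pos
  set N : V → Finset V := fun y => {a ∈ A | R a y} with hN
  let bad : V → V → Prop := fun a x => (#{y ∈ A | R a y ∧ R x y} : ℝ) < α ^ 2 / 32 * #A
  have hsq : α ^ 2 * (#A : ℝ) ^ 3 ≤ ∑ y ∈ A, (#(N y) : ℝ) ^ 2 := by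
    have h := sq_sum_le_card_mul_sum_sq (s := A) (f := fun y => (#(N y) : ℝ))
    have h2 : (α * (#A : ℝ) ^ 2) ^ 2 ≤ (∑ y ∈ A, (#(N y) : ℝ)) ^ 2 :=
      pow_le_pow_left₀ (by positivity) hR 2
    refine le_of_mul_le_mul_left ?_ hn
    calc _ = (α * (#A : ℝ) ^ 2) ^ 2 := by ring
      _ ≤ _ := h2.trans h
  have hbad : ∑ y ∈ A, (#{p ∈ N y ×ˢ N y | bad p.1 p.2} : ℝ) ≤ α ^ 2 / 32 * (#A : ℝ) ^ 3 := by
    have h1 : ∑ y ∈ A, #{p ∈ N y ×ˢ N y | bad p.1 p.2}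
        = ∑ p ∈ A ×ˢ A with bad p.1 p.2, #{y ∈ A | R p.1 y ∧ R p.2 y} := by
      have h3 : ∀ y, ({p ∈ N y ×ˢ N y | bad p.1 p.2} : Finset (V × V))
          = {p ∈ {p ∈ A ×ˢ A | bad p.1 p.2} | R p.1 y ∧ R p.2 y} := by
        intro y
        ext p
        simp only [hN, mem_filter, mem_product]
        tauto
      simp only [h3]
      exact (sum_card_bipartiteAbove_eq_sum_card_bipartiteBelow
        (fun y (p : V × V) => R p.1 y ∧ R p.2 y))
    have h2 : (∑ p ∈ A ×ˢ A with bad p.1 p.2, (#{y ∈ A | R p.1 y ∧ R p.2 y} : ℝ))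
        ≤ ∑ p ∈ A ×ˢ A with bad p.1 p.2, α ^ 2 / 32 * #A :=
      sum_le_sum fun p hp => (mem_filter.1 hp).2.le
    have h4 : (#{p ∈ A ×ˢ A | bad p.1 p.2} : ℝ) ≤ (#A : ℝ) ^ 2 := by
      have h := (card_filter_le (A ×ˢ A) fun p => bad p.1 p.2).trans (card_product A A).le
      calc _ ≤ ((#A * #A : ℕ) : ℝ) := Nat.cast_le.2 h
        _ = _ := by push_cast; ring
    rw [sum_const, nsmul_eq_mul] at h2
    calc _ = ∑ p ∈ A ×ˢ A with bad p.1 p.2, (#{y ∈ A | R p.1 y ∧ R p.2 y} : ℝ) := by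
          exact_mod_cast h1
      _ ≤ _ := h2
      _ ≤ (#A : ℝ) ^ 2 * (α ^ 2 / 32 * #A) := by gcongr
      _ = _ := by ring
  obtain ⟨y, -, hy⟩ : ∃ y ∈ A, α ^ 2 * (#A : ℝ) ^ 2 / 2 ≤
      (#(N y) : ℝ) ^ 2 - 16 * #{p ∈ N y ×ˢ N y | bad p.1 p.2} := by
    refine exists_le_of_sum_le hA ?_
    rw [sum_const, nsmul_eq_mul, sum_sub_distrib, ← mul_sum]
    linarith
  set X := N y with hX
  set B : V → Finset V := fun a => {x ∈ X | bad a x} with hB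
  have hcardX : α * #A / 2 ≤ #X := by
    refine le_of_sq_le_sq ?_ (Nat.cast_nonneg _)
    have : (0 : ℝ) ≤ #{p ∈ X ×ˢ X | bad p.1 p.2} := Nat.cast_nonneg _
    nlinarith [sq_nonneg (α * #A)]
  have hX0 : (0 : ℝ) < #X := lt_of_lt_of_le (by positivity) hcardX
  have hBsum : ∑ a ∈ X, (#(B a) : ℝ) ≤ (#X : ℝ) ^ 2 / 16 := by
    have h : #{p ∈ X ×ˢ X | bad p.1 p.2} = ∑ a ∈ X, #(B a) := by
      simp only [hB, card_filter]
      rw [sum_product]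
    have h' : (#{p ∈ X ×ˢ X | bad p.1 p.2} : ℝ) = ∑ a ∈ X, (#(B a) : ℝ) := by exact_mod_cast h
    rw [← h']
    nlinarith [sq_nonneg (α * #A)]
  refine ⟨X, filter_subset _ _, {a ∈ X | (#(B a) : ℝ) < #X / 4}, filter_subset _ _, hcardX, ?_, ?_⟩
  · have h1 := card_filter_add_card_filter_not (s := X) (fun a => (#(B a) : ℝ) < #X / 4)
    have h1' : (#{a ∈ X | (#(B a) : ℝ) < #X / 4} : ℝ) + #{a ∈ X | ¬ (#(B a) : ℝ) < #X / 4} = #X := by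
      exact_mod_cast h1
    have h2 : (#{a ∈ X | ¬ (#(B a) : ℝ) < #X / 4} : ℝ) * (#X / 4) ≤ (#X : ℝ) ^ 2 / 16 := by
      refine le_trans ?_ hBsum
      rw [← nsmul_eq_mul]
      refine (card_nsmul_le_sum _ (fun a => (#(B a) : ℝ)) _
        fun a ha => not_lt.1 (mem_filter.1 ha).2).trans ?_
      exact sum_le_sum_of_subset_of_nonneg (filter_subset _ _) fun _ _ _ => Nat.cast_nonneg _
    have h3 : (#{a ∈ X | ¬ (#(B a) : ℝ) < #X / 4} : ℝ) ≤ #X / 4 := by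
      refine le_of_mul_le_mul_right (h2.trans (le_of_eq ?_)) (by positivity : (0 : ℝ) < #X / 4)
      ring
    linarith
  · intro a ha b hb
    have ha' := (mem_filter.1 ha).2
    have hb' := (mem_filter.1 hb).2
    have hsub : X ⊆ {x ∈ X | α ^ 2 / 32 * #A ≤ #{y ∈ A | R a y ∧ R x y} ∧
          α ^ 2 / 32 * #A ≤ #{y ∈ A | R b y ∧ R x y}} ∪ (B a ∪ B b) := by
      intro x hx
      simp only [hB, bad, mem_union, mem_filter, hx, true_and, ← not_le]
      tauto
    have h := (card_le_card hsub).trans ((card_union_le _ _).trans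
      (Nat.add_le_add_left (card_union_le _ _) _))
    have h' := (Nat.cast_le (α := ℝ)).2 h
    push_cast at h'
    linarith

open Finset in
/-- If any two elements of `A'` are joined by many paths of length four whose edges have sums
in `S`, then `A' - A'` is small. -/
theorem card_sub_mul_le_of_paths {A X A' S : Finset ℤ} {m l : ℝ} (hl : 0 ≤ l)
    (h : ∀ a ∈ A', ∀ b ∈ A', m ≤
      #{x ∈ X | l ≤ #{y ∈ A | a + y ∈ S ∧ x + y ∈ S} ∧ l ≤ #{y ∈ A | b + y ∈ S ∧ x + y ∈ S}}) :
    (#(A' - A') : ℝ) * (m * l ^ 2) ≤ (#S : ℝ) ^ 4 := by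
  set f : ℤ × ℤ × ℤ × ℤ → ℤ := fun q => q.1 - q.2.1 + q.2.2.1 - q.2.2.2 with hf
  set Q := S ×ˢ S ×ˢ S ×ˢ S with hQ
  have key : ∀ d ∈ A' - A', m * l ^ 2 ≤ (#{q ∈ Q | f q = d} : ℝ) := by
    intro d hd
    obtain ⟨a, ha, b, hb, rfl⟩ := mem_sub.1 hd
    set Y := {x ∈ X | l ≤ #{y ∈ A | a + y ∈ S ∧ x + y ∈ S} ∧
      l ≤ #{y ∈ A | b + y ∈ S ∧ x + y ∈ S}} with hY
    set T : Finset (Σ _ : ℤ, ℤ × ℤ) := Y.sigma fun x =>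
      {y ∈ A | a + y ∈ S ∧ x + y ∈ S} ×ˢ {y ∈ A | b + y ∈ S ∧ x + y ∈ S} with hT
    have h1 : m * l ^ 2 ≤ (#T : ℝ) := by
      rw [hT, card_sigma]
      push_cast [card_product]
      calc m * l ^ 2 ≤ #Y * l ^ 2 := by
            gcongr
            exact h a ha b hb
        _ = ∑ x ∈ Y, l ^ 2 := by rw [sum_const, nsmul_eq_mul]
        _ ≤ _ := by
          refine sum_le_sum fun x hx => ?_
          rw [sq]
          have hx' := (mem_filter.1 hx).2
          exact mul_le_mul hx'.1 hx'.2 hl (Nat.cast_nonneg _)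
    refine h1.trans ?_
    norm_cast
    refine card_le_card_of_injOn
      (fun t => (a + t.2.1, t.1 + t.2.1, t.1 + t.2.2, b + t.2.2)) ?_ ?_
    · rintro ⟨x, y, z⟩ ht
      simp only [hT, coe_sigma, Set.mem_sigma_iff, mem_coe, mem_product, mem_filter] at ht
      simp only [hQ, hf, coe_filter, mem_product, Set.mem_ofPred_eq]
      refine ⟨⟨ht.2.1.2.1, ht.2.1.2.2, ht.2.2.2.2, ht.2.2.2.1⟩, ?_⟩
      ring
    · rintro ⟨x, y, z⟩ - ⟨x', y', z'⟩ - e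
      simp only [Prod.mk.injEq] at e
      obtain rfl : y = y' := by omega
      obtain rfl : z = z' := by omega
      obtain rfl : x = x' := by omega
      rfl
  have hcard : (#Q : ℝ) = (#S : ℝ) ^ 4 := by
    rw [hQ]
    push_cast [card_product]
    ring
  rw [← hcard, ← nsmul_eq_mul]
  refine (card_nsmul_le_sum _ _ _ key).trans ?_
  norm_cast
  exact (sum_card_fiberwise_eq_card_filter _ _ _).trans_le (card_filter_le _ _)

open Finset in
/-- A special case of the Plünnecke–Ruzsa inequality over the reals. -/
theorem card_add_self_mul_card_le (A : Finset ℤ) (hA : A.Nonempty) :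
    (#(A + A) : ℝ) * #A ≤ (#(A - A) : ℝ) ^ 2 := by
  have hn : (0 : ℝ) < #A := by exact_mod_cast hA.card_pos
  have h := pluennecke_ruzsa_inequality_nsmul_sub hA A 2
  rw [two_nsmul] at h
  have h' := (NNRat.cast_le (K := ℝ)).2 h
  push_cast at h'
  calc (#(A + A) : ℝ) * #A ≤ ((#(A - A) : ℝ) / #A) ^ 2 * #A * #A := by gcongr
    _ = _ := by field_simp

theorem bsg_subset_small_doubling :
    ∃ c C : ℝ, 0 < c ∧ 0 < C ∧
      ∀ (A : Finset ℤ) (n : ℕ), A.card = n → 1 ≤ n →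
        ∀ K : ℝ, 1 ≤ K → (n : ℝ) ^ 3 / K ≤ (additiveEnergy A : ℝ) →
          ∃ A' ⊆ A, c * n / K ^ 2 ≤ (A'.card : ℝ) ∧
            ((A' + A').card : ℝ) ≤ C * n * K ^ 28 := by
  refine ⟨1 / 8, 2 ^ 45, by norm_num, by norm_num, ?_⟩
  rintro A _ rfl hn1 K hK hE
  have hA : A.Nonempty := Finset.card_pos.1 hn1
  obtain ⟨S, hS, hG⟩ := exists_popular_sums A hA hK hE
  set n : ℝ := (A.card : ℝ) with hn
  have hn0 : 0 < n := by simpa [hn] using hA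
  have hK0 : 0 < K := by linarith
  obtain ⟨X, hXA, A', hA'X, hX, hA', hpath⟩ := exists_subset_many_paths A (fun a y => a + y ∈ S)
    (α := 1 / (2 * K)) hA (by positivity) (by
      refine le_trans (le_of_eq ?_) (hG.trans (le_of_eq ?_))
      · rw [hn]; ring
      · exact Finset.sum_congr rfl fun y _ => by congr!)
  rw [← hn] at hX hpath
  have hX' : n / (4 * K) ≤ X.card := by
    refine le_trans (le_of_eq ?_) hX
    field_simp
    norm_num
  have hA'1 : n / (8 * K) ≤ A'.card := by
    have h0 : 0 < n / (4 * K) := by positivity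
    have h1 : n / (8 * K) = n / (4 * K) / 2 := by field_simp; norm_num
    linarith
  have hA'0 : (0 : ℝ) < A'.card := lt_of_lt_of_le (by positivity) hA'1
  have hdiff : ((A' - A').card : ℝ) * (n / (8 * K) * (n / (128 * K ^ 2)) ^ 2)
      ≤ (2 * K * n) ^ 4 := by
    refine le_trans ?_ (pow_le_pow_left₀ (Nat.cast_nonneg _) hS 4)
    refine card_sub_mul_le_of_paths (A := A) (X := X) (by positivity) fun a ha b hb => ?_
    refine le_trans ?_ ((hpath a ha b hb).trans (le_of_eq ?_))
    · have h1 : n / (8 * K) = n / (4 * K) / 2 := by field_simp; norm_num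
      linarith
    · have hl : (1 / (2 * K)) ^ 2 / 32 * n = n / (128 * K ^ 2) := by field_simp; norm_num
      rw [hl]
      congr!
  have hdiff' : ((A' - A').card : ℝ) ≤ 2 ^ 21 * K ^ 9 * n := by
    refine le_of_mul_le_mul_right (hdiff.trans (le_of_eq ?_))
      (by positivity : 0 < n / (8 * K) * (n / (128 * K ^ 2)) ^ 2)
    field_simp
    norm_num
  refine ⟨A', hA'X.trans hXA, le_trans ?_ hA'1, ?_⟩
  · rw [div_le_div_iff₀ (by positivity) (by positivity)]
    nlinarith [mul_le_mul_of_nonneg_left hK (by positivity : 0 ≤ n * K)]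
  · have hpr := card_add_self_mul_card_le A' (Finset.card_pos.1 (by exact_mod_cast hA'0))
    have h1 : ((A' + A').card : ℝ) * (n / (8 * K)) ≤ (2 ^ 21 * K ^ 9 * n) ^ 2 :=
      (mul_le_mul_of_nonneg_left hA'1 (Nat.cast_nonneg _)).trans
        (hpr.trans (pow_le_pow_left₀ (Nat.cast_nonneg _) hdiff' 2))
    have h2 : ((A' + A').card : ℝ) ≤ 2 ^ 45 * n * K ^ 19 := by
      refine le_of_mul_le_mul_right (h1.trans (le_of_eq ?_)) (by positivity : 0 < n / (8 * K))
      field_simp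
      norm_num
    refine h2.trans ?_
    gcongr
    norm_num
end

section
/- There exists a constant c > 0 such that the following holds: for all integers U ≥ 2 and n ≥ 2, and all finite sets A, B, C ⊆ ℤ ∩ [−U, U] with A nonempty, |B| ≤ n, and |C| ≤ n, there exist an integer m ≥ 1, integers s₁, …, s_m, a partition of B into disjoint subsets B₁, …, B_m, and subsets C₁, …, C_m ⊆ C such that: (i) Bᵢ ⊆ sᵢ + A for all i; (ii) C ∩ (−(A + Bᵢ)) ⊆ Cᵢ for all i; and (iii) Σᵢ |Cᵢ| ≤ c · (|A + A| / |A|) · n · log n. -/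
open Pointwise

/-- Some translate `s + A` meets `R` in many points, compared with the number of `c ∈ C` such that
`-c` lies in `s + A + A`. -/
lemma exists_efficient_translate {G : Type*} [AddCommGroup G] [DecidableEq G] (A R C : Finset G)
    (hA : A.Nonempty) (hR : R.Nonempty) :
    ∃ s : G, (R.filter fun b => b - s ∈ A).Nonempty ∧
      (C.filter fun c => -c - s ∈ A + A).card * (R.card * A.card) ≤
        (R.filter fun b => b - s ∈ A).card * (C.card * (A + A).card) := by
  have hcount : ∀ b ∈ R, ((R - A).filter fun s => b - s ∈ A).card = A.card := by
    intro b hb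
    refine Finset.card_nbij' (fun s => b - s) (fun a => b - a) ?_ ?_ ?_ ?_
    · intro s hs
      exact (Finset.mem_filter.mp hs).2
    · intro a ha
      simp only [Finset.coe_filter, Set.mem_ofPred_eq, sub_sub_cancel]
      exact ⟨Finset.sub_mem_sub hb ha, ha⟩
    · intro s _
      simp
    · intro a _
      simp
  have hcount' : ∀ c ∈ C, ((R - A).filter fun s => -c - s ∈ A + A).card ≤ (A + A).card := by
    intro c _
    refine Finset.card_le_card_of_injOn (fun s => -c - s) ?_ ?_
    · intro s hs
      exact (Finset.mem_filter.mp hs).2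
    · intro s _ t _ hst
      simpa using hst
  have hsum : ∑ s ∈ R - A, (R.filter fun b => b - s ∈ A).card = R.card * A.card := by
    have h := Finset.sum_card_bipartiteAbove_eq_sum_card_bipartiteBelow
      (s := R - A) (t := R) (fun s b => b - s ∈ A)
    simp only [Finset.bipartiteAbove, Finset.bipartiteBelow] at h
    rw [h, Finset.sum_congr rfl hcount, Finset.sum_const, smul_eq_mul]
  have hsum' : ∑ s ∈ R - A, (C.filter fun c => -c - s ∈ A + A).card ≤ C.card * (A + A).card := by
    have h := Finset.sum_card_bipartiteAbove_eq_sum_card_bipartiteBelow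
      (s := R - A) (t := C) (fun s c => -c - s ∈ A + A)
    simp only [Finset.bipartiteAbove, Finset.bipartiteBelow] at h
    rw [h]
    exact (Finset.sum_le_card_nsmul _ _ _ hcount').trans_eq (smul_eq_mul _ _)
  obtain ⟨s, hs, hle⟩ := Finset.exists_le_of_sum_le (s := R - A)
    (f := fun s => (C.filter fun c => -c - s ∈ A + A).card * (R.card * A.card))
    (g := fun s => (R.filter fun b => b - s ∈ A).card * (C.card * (A + A).card)) (hR.sub hA) (by
      rw [← Finset.sum_mul, ← Finset.sum_mul, hsum, mul_comm]
      exact Nat.mul_le_mul_left _ hsum')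
  refine ⟨s, ?_, hle⟩
  obtain ⟨b, hb, a, ha, rfl⟩ := Finset.mem_sub.mp hs
  exact ⟨b, Finset.mem_filter.mpr ⟨hb, by simpa using ha⟩⟩

lemma div_le_harmonic_sub_harmonic (r d N : ℕ) (h : r + d ≤ N) :
    (d : ℚ) / N ≤ harmonic (r + d) - harmonic r := by
  induction d with
  | zero => simp
  | succ d ih =>
    have h1 := ih (by omega)
    have h2 : (1 : ℚ) / N ≤ ((r + d + 1 : ℕ) : ℚ)⁻¹ := by
      rw [one_div]
      exact inv_anti₀ (by positivity) (by exact_mod_cast h)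
    rw [← add_assoc, harmonic_succ, Nat.cast_succ, add_div]
    linarith

/-- A greedy decomposition of `B` into subsets of translates of `A`. -/
lemma exists_greedy_decomposition {G : Type*} [AddCommGroup G] [DecidableEq G] (A C : Finset G)
    (hA : A.Nonempty) (B : Finset G) :
    ∃ (m : ℕ) (s : Fin (m + 1) → G) (Bs : Fin (m + 1) → Finset G),
      (∀ i j, i ≠ j → Disjoint (Bs i) (Bs j)) ∧
      Finset.univ.biUnion Bs = B ∧
      (∀ i, Bs i ⊆ A.image fun a => s i + a) ∧
      ∑ i, ((C ∩ -(A + Bs i)).card : ℚ) ≤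
        ((A + A).card : ℚ) / A.card * C.card * harmonic B.card := by
  induction B using Finset.strongInduction with
  | H R ih =>
    obtain rfl | hR := R.eq_empty_or_nonempty
    · exact ⟨0, fun _ => 0, fun _ => ∅, by simp, by simp, by simp, by simp⟩
    obtain ⟨s₀, hne, hle⟩ := exists_efficient_translate A R C hA hR
    set B₀ := R.filter fun b => b - s₀ ∈ A
    have hsub : B₀ ⊆ R := Finset.filter_subset _ _
    obtain ⟨m, s, Bs, hdisj, hunion, htrans, hcard⟩ := ih (R \ B₀) (Finset.sdiff_ssubset hsub hne)
    have hBs : ∀ i, Disjoint B₀ (Bs i) := fun i =>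
      Finset.disjoint_sdiff.mono_right (hunion ▸ Finset.subset_biUnion_of_mem Bs (Finset.mem_univ i))
    refine ⟨m + 1, Fin.cons s₀ s, Fin.cons B₀ Bs, ?_, ?_, ?_, ?_⟩
    · intro i j
      refine Fin.cases ?_ (fun i => ?_) i <;> refine Fin.cases ?_ (fun j => ?_) j
      · simp
      · exact fun _ => by simpa using hBs j
      · exact fun _ => by simpa using (hBs i).symm
      · simpa using hdisj i j
    · have hcons : Finset.univ.biUnion (Fin.cons B₀ Bs : Fin (m + 1 + 1) → Finset G) =
          B₀ ∪ Finset.univ.biUnion Bs := by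
        ext x
        simp [Fin.exists_fin_succ]
      rw [hcons, hunion, Finset.union_sdiff_of_subset hsub]
    · refine Fin.cases ?_ (fun i => by simpa using htrans i)
      intro b hb
      rw [Fin.cons_zero] at hb
      exact Finset.mem_image.mpr ⟨b - s₀, (Finset.mem_filter.mp hb).2, by simp⟩
    · rw [Fin.sum_univ_succ]
      simp only [Fin.cons_zero, Fin.cons_succ]
      have hC : C ∩ -(A + B₀) ⊆ C.filter fun c => -c - s₀ ∈ A + A := by
        intro c hc
        obtain ⟨hcC, hc⟩ := Finset.mem_inter.mp hc
        obtain ⟨a, ha, b, hb, hab⟩ := Finset.mem_add.mp (Finset.mem_neg'.mp hc)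
        refine Finset.mem_filter.mpr ⟨hcC, ?_⟩
        rw [← hab, add_sub_assoc]
        exact Finset.add_mem_add ha (Finset.mem_filter.mp hb).2
      have hA0 : (0 : ℚ) < A.card := by exact_mod_cast hA.card_pos
      have hR0 : (0 : ℚ) < R.card := by exact_mod_cast hR.card_pos
      have hfirst : ((C ∩ -(A + B₀)).card : ℚ) ≤
          ((A + A).card : ℚ) / A.card * C.card * (B₀.card / R.card) := by
        have h : ((C ∩ -(A + B₀)).card : ℚ) * (R.card * A.card) ≤
            B₀.card * (C.card * (A + A).card) := by
          exact_mod_cast (Nat.mul_le_mul_right _ (Finset.card_le_card hC)).trans hle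
        calc ((C ∩ -(A + B₀)).card : ℚ) ≤
            B₀.card * (C.card * (A + A).card) / (R.card * A.card) :=
              (le_div_iff₀ (by positivity)).mpr h
          _ = _ := by field_simp
      have hsplit : (R \ B₀).card + B₀.card = R.card := Finset.card_sdiff_add_card_eq_card hsub
      have hharm := div_le_harmonic_sub_harmonic (R \ B₀).card B₀.card R.card hsplit.le
      rw [hsplit] at hharm
      have hmul := mul_le_mul_of_nonneg_left hharm
        (show 0 ≤ ((A + A).card : ℚ) / A.card * C.card by positivity)
      rw [mul_sub] at hmul
      linarith

theorem decomposition_lemma :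
    ∃ c : ℝ, 0 < c ∧
      ∀ (U n : ℕ), 2 ≤ U → 2 ≤ n →
        ∀ A B C : Finset ℤ,
          A ⊆ Finset.Icc (-(U : ℤ)) (U : ℤ) → B ⊆ Finset.Icc (-(U : ℤ)) (U : ℤ) →
          C ⊆ Finset.Icc (-(U : ℤ)) (U : ℤ) →
          A.Nonempty → B.card ≤ n → C.card ≤ n →
          ∃ (m : ℕ) (s : Fin m → ℤ) (Bs Cs : Fin m → Finset ℤ),
            1 ≤ m ∧
            (∀ i j, i ≠ j → Disjoint (Bs i) (Bs j)) ∧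
            Finset.univ.biUnion Bs = B ∧
            (∀ i, Bs i ⊆ A.image fun a => s i + a) ∧
            (∀ i, Cs i ⊆ C) ∧
            (∀ i, C ∩ (-(A + Bs i)) ⊆ Cs i) ∧
            (∑ i, ((Cs i).card : ℝ)) ≤ c * (((A + A).card : ℝ) / (A.card : ℝ)) * n * Real.log n := by
  refine ⟨3, by norm_num, ?_⟩
  intro U n _ hn A B C _ _ _ hA hB hC
  obtain ⟨m, s, Bs, hdisj, hunion, htrans, hcard⟩ := exists_greedy_decomposition A C hA B
  refine ⟨m + 1, s, Bs, fun i => C ∩ -(A + Bs i), by omega, hdisj, hunion, htrans,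
    fun i => Finset.inter_subset_left, fun i => subset_rfl, ?_⟩
  have hcardR : ∑ i, ((C ∩ -(A + Bs i)).card : ℝ) ≤
      ((A + A).card : ℝ) / A.card * C.card * (harmonic B.card : ℝ) := by
    have h := (Rat.cast_le (K := ℝ)).mpr hcard
    push_cast at h
    exact h
  have hn2 : (2 : ℝ) ≤ n := by exact_mod_cast hn
  have hlog2 : Real.log 2 ≤ Real.log n := Real.log_le_log (by norm_num) hn2
  have hlog : 1 + Real.log n ≤ 3 * Real.log n := by
    linarith [Real.log_two_gt_d9]
  have hmono : (harmonic B.card : ℝ) ≤ harmonic n := by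
    have h := div_le_harmonic_sub_harmonic B.card (n - B.card) n (by omega)
    rw [Nat.add_sub_cancel' hB] at h
    have h0 : (0 : ℚ) ≤ ((n - B.card : ℕ) : ℚ) / n := by positivity
    exact_mod_cast sub_nonneg.mp (h0.trans h)
  have hharm : (harmonic B.card : ℝ) ≤ 3 * Real.log n :=
    (hmono.trans (harmonic_le_one_add_log n)).trans hlog
  have hCn : (C.card : ℝ) ≤ n := by exact_mod_cast hC
  calc _ ≤ ((A + A).card : ℝ) / A.card * C.card * (harmonic B.card : ℝ) := hcardR
    _ ≤ ((A + A).card : ℝ) / A.card * C.card * (3 * Real.log n) := by gcongr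
    _ ≤ ((A + A).card : ℝ) / A.card * n * (3 * Real.log n) := by gcongr
    _ = _ := by ring
end
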